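/- General bilinear paraproduct estimate (Proposition 2.6(i)). Let α₁, α₂, β₁, β₂ ∈ ℝ∖{0} and γ₁, γ₂ ∈ ℝ satisfy γ_j ≤ min(α_j, β_j) and α_j + β_j > 0 for j = 1, 2. Then there is a constant C, depending only on these six exponents, such that for all C_b^∞ functions F, G: ℝ² → ℝ one has ‖F·G‖_{C_u^{γ₁}C_v^{γ₂}} ≤ C‖F‖_{C_u^{α₁}C_v^{α₂}}‖G‖_{C_u^{β₁}C_v^{β₂}} (an inequality in [0,∞]). -/

import Mathlib

noncomputable section

open Real MeasureTheory
open scoped ENNReal Classical NNReal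

/-- A function between real normed spaces is `C_b^∞`: it is smooth and it together with all of
its iterated derivatives is bounded. -/
def CbSmooth {E F : Type*} [NormedAddCommGroup E] [NormedSpace ℝ E]
    [NormedAddCommGroup F] [NormedSpace ℝ F] (f : E → F) : Prop :=
  ContDiff ℝ (⊤ : ℕ∞) f ∧ ∀ n : ℕ, ∃ C : ℝ, ∀ x : E, ‖iteratedFDeriv ℝ n f x‖ ≤ C

/-- An admissible Littlewood–Paley cutoff: a smooth even `[0,1]`-valued function which is `≡ 1`
on `{|ξ| ≤ 7/8}` and vanishes on `{|ξ| ≥ 9/8}`. -/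
structure IsLPCutoff (ρ : ℝ → ℝ) : Prop where
  smooth : ContDiff ℝ (⊤ : ℕ∞) ρ
  nonneg : ∀ ξ, 0 ≤ ρ ξ
  le_one : ∀ ξ, ρ ξ ≤ 1
  even : ∀ ξ, ρ (-ξ) = ρ ξ
  eq_one : ∀ ξ : ℝ, |ξ| ≤ 7 / 8 → ρ ξ = 1
  eq_zero : ∀ ξ : ℝ, 9 / 8 ≤ |ξ| → ρ ξ = 0

/-- The Littlewood–Paley symbol `ρ_N` at the dyadic scale `N = 2 ^ k`. -/
def lpSymbol (ρ : ℝ → ℝ) : ℕ → ℝ → ℝ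
  | 0 => ρ
  | k + 1 => fun ξ => ρ (ξ / 2 ^ (k + 1)) - ρ (2 * ξ / 2 ^ (k + 1))

/-- The inverse Fourier transform `(2π)^{-1/2} ∫ e^{ixξ} g(ξ) dξ` of a real even function,
written as a cosine transform. -/
def invFourier (g : ℝ → ℝ) (x : ℝ) : ℝ :=
  (Real.sqrt (2 * Real.pi))⁻¹ * ∫ ξ : ℝ, Real.cos (x * ξ) * g ξ

/-- The Littlewood–Paley convolution kernel `ρ̌_N`, `N = 2 ^ k`. -/
def lpKernel (ρ : ℝ → ℝ) (k : ℕ) : ℝ → ℝ :=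
  invFourier (lpSymbol ρ k)

/-- The Littlewood–Paley projection `P_N f = ρ̌_N ∗ f`, `N = 2 ^ k`. -/
def LP (ρ : ℝ → ℝ) (k : ℕ) (f : ℝ → ℝ) (x : ℝ) : ℝ :=
  ∫ y : ℝ, lpKernel ρ k y * f (x - y)

/-- The Littlewood–Paley projection in the first variable. -/
def LPu (ρ : ℝ → ℝ) (k : ℕ) (F : ℝ × ℝ → ℝ) (p : ℝ × ℝ) : ℝ :=
  ∫ y : ℝ, lpKernel ρ k y * F (p.1 - y, p.2)

/-- The Littlewood–Paley projection in the second variable. -/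
def LPv (ρ : ℝ → ℝ) (k : ℕ) (F : ℝ × ℝ → ℝ) (p : ℝ × ℝ) : ℝ :=
  ∫ y : ℝ, lpKernel ρ k y * F (p.1, p.2 - y)

/-- The Hölder norm `‖f‖_{C^γ} = sup_N N^γ ‖P_N f‖_{L^∞}`, valued in `[0,∞]`. -/
def hNorm (ρ : ℝ → ℝ) (γ : ℝ) (f : ℝ → ℝ) : ℝ≥0∞ :=
  ⨆ k : ℕ, ENNReal.ofReal (((2 : ℝ) ^ k) ^ γ) * ⨆ x : ℝ, ENNReal.ofReal |LP ρ k f x|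

/-- The product Hölder norm `‖F‖_{C_u^{γ₁} C_v^{γ₂}}`, valued in `[0,∞]`. -/
def hNorm2 (ρ : ℝ → ℝ) (γ₁ γ₂ : ℝ) (F : ℝ × ℝ → ℝ) : ℝ≥0∞ :=
  ⨆ k₁ : ℕ, ⨆ k₂ : ℕ,
    ENNReal.ofReal (((2 : ℝ) ^ k₁) ^ γ₁ * ((2 : ℝ) ^ k₂) ^ γ₂) *
      ⨆ p : ℝ × ℝ, ENNReal.ofReal |LPu ρ k₁ (LPv ρ k₂ F) p|

/-- `2 ^ k₁ ∼ 2 ^ k₂`: comparable dyadic scales. -/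
def DClose (k₁ k₂ : ℕ) : Prop :=
  (2 : ℝ) ^ k₂ / 2 ^ 10 < (2 : ℝ) ^ k₁ ∧ (2 : ℝ) ^ k₁ < 2 ^ 10 * (2 : ℝ) ^ k₂

/-- `2 ^ k₁ ≪ 2 ^ k₂`. -/
def DLow (k₁ k₂ : ℕ) : Prop := (2 : ℝ) ^ k₁ ≤ (2 : ℝ) ^ k₂ / 2 ^ 10

/-- `2 ^ k₁ ≳ 2 ^ k₂`. -/
def DGtr (k₁ k₂ : ℕ) : Prop := (2 : ℝ) ^ k₂ ≤ 2 ^ 10 * (2 : ℝ) ^ k₁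

/-! ### Fourier facts about the kernels -/

structure BPSym (σ : ℝ → ℝ) : Prop where
  smooth : ContDiff ℝ (⊤ : ℕ∞) σ
  even : ∀ ξ, σ (-ξ) = σ ξ
  supp : HasCompactSupport σ

lemma BPSym.integrable {σ : ℝ → ℝ} (h : BPSym σ) : Integrable σ :=
  h.smooth.continuous.integrable_of_hasCompactSupport h.supp

def BPc : ℝ := (Real.sqrt (2 * Real.pi))⁻¹

lemma BPc_pos : 0 < BPc := by unfold BPc; positivity

lemma BPc_sq : BPc * (2 * Real.pi) = Real.sqrt (2 * Real.pi) := by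
  unfold BPc
  have h : 0 < Real.sqrt (2 * Real.pi) := by positivity
  have h2 : Real.sqrt (2 * Real.pi) * Real.sqrt (2 * Real.pi) = 2 * Real.pi :=
    Real.mul_self_sqrt (by positivity)
  field_simp
  nlinarith

lemma BPSym.exp_integrable {σ : ℝ → ℝ} (h : BPSym σ) (y : ℝ) :
    Integrable (fun ξ : ℝ => Complex.exp (Complex.I * (y * ξ)) * (σ ξ : ℂ)) := by
  refine Integrable.bdd_mul (c := 1) h.integrable.ofReal ?_ ?_
  · exact (by fun_prop : Continuous fun ξ : ℝ => Complex.exp (Complex.I * (y * ξ))).aestronglyMeasurable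
  · refine Filter.Eventually.of_forall fun ξ => ?_
    rw [Complex.norm_exp]; simp

lemma BPSym.kernel_eq {σ : ℝ → ℝ} (h : BPSym σ) (y : ℝ) :
    (invFourier σ y : ℂ) = BPc * ∫ ξ : ℝ, Complex.exp (Complex.I * (y * ξ)) * (σ ξ : ℂ) := by
  have hsymm : ∫ ξ : ℝ, Complex.exp (Complex.I * (y * ξ)) * (σ ξ : ℂ)
      = ∫ ξ : ℝ, Complex.exp (-(Complex.I * (y * ξ))) * (σ ξ : ℂ) := by
    rw [← integral_neg_eq_self]
    congr 1; ext ξ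
    rw [h.even]; push_cast; ring_nf
  have hi2 : Integrable (fun ξ : ℝ => Complex.exp (-(Complex.I * (y * ξ))) * (σ ξ : ℂ)) := by
    have := h.exp_integrable (-y)
    refine this.congr (Filter.Eventually.of_forall fun ξ => ?_)
    simp only []; push_cast; ring_nf
  have hcos : ∫ ξ : ℝ, ((Real.cos (y * ξ) * σ ξ : ℝ) : ℂ)
      = ∫ ξ : ℝ, Complex.exp (Complex.I * (y * ξ)) * (σ ξ : ℂ) := by
    have h1 : ∀ ξ : ℝ, ((Real.cos (y * ξ) * σ ξ : ℝ) : ℂ)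
        = (1/2 : ℂ) * (Complex.exp (Complex.I * (y * ξ)) * (σ ξ : ℂ)
          + Complex.exp (-(Complex.I * (y * ξ))) * (σ ξ : ℂ)) := by
      intro ξ
      push_cast
      rw [Complex.cos]
      ring_nf
    simp_rw [h1]
    rw [integral_const_mul, integral_add (h.exp_integrable y) hi2, ← hsymm]
    ring
  unfold invFourier
  rw [Complex.ofReal_mul, ← integral_complex_ofReal, hcos]
  rfl

open FourierTransform SchwartzMap in
lemma BPSym.main {σ : ℝ → ℝ} (h : BPSym σ) :
    Continuous (invFourier σ) ∧ Integrable (invFourier σ) ∧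
    ∀ ζ : ℝ, ∫ y : ℝ, (invFourier σ y : ℂ) * Complex.exp (Complex.I * (y * ζ))
      = Real.sqrt (2 * Real.pi) * σ ζ := by
  have hs : HasCompactSupport (fun ξ => (σ ξ : ℂ)) := h.supp.comp_left (g := Complex.ofReal) rfl
  have hd : ContDiff ℝ (⊤ : ℕ∞) (fun ξ => (σ ξ : ℂ)) := Complex.ofRealCLM.contDiff.comp h.smooth
  set S : 𝓢(ℝ, ℂ) := hs.toSchwartzMap hd with hS
  have hSa : ∀ x, S x = (σ x : ℂ) := fun x => rfl
  have hpi : (2 * Real.pi) ≠ 0 := by positivity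
  have key : ∀ y : ℝ, (invFourier σ y : ℂ) = BPc * (𝓕 S) (y / (2 * Real.pi)) := by
    intro y
    rw [h.kernel_eq, SchwartzMap.fourier_coe, Real.fourier_real_eq_integral_exp_smul,
      ← integral_neg_eq_self]
    congr 2; ext ξ
    rw [hSa, h.even, smul_eq_mul]
    congr 2
    have : (Real.pi : ℂ) ≠ 0 := by exact_mod_cast Real.pi_ne_zero
    push_cast; field_simp
  have hcC : Continuous (fun y => (invFourier σ y : ℂ)) := by
    simp_rw [key]
    exact continuous_const.mul ((𝓕 S).continuous.comp (continuous_id.div_const _))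
  have hiC : Integrable (fun y => (invFourier σ y : ℂ)) := by
    simp_rw [key]
    exact (((𝓕 S).integrable (μ := volume)).comp_div hpi).const_mul _
  refine ⟨?_, ?_, ?_⟩
  · have := Complex.continuous_re.comp hcC
    simpa [Function.comp_def] using this
  · simpa using hiC.re
  · intro ζ
    simp_rw [key]
    have h1 : ∫ y : ℝ, (BPc : ℂ) * (𝓕 S) (y / (2 * Real.pi)) * Complex.exp (Complex.I * (y * ζ))
       = ∫ y : ℝ, (fun t : ℝ => (BPc : ℂ) * ((𝓕 S) t * Complex.exp (2 * Real.pi * Complex.I * (t * ζ)))) (y / (2 * Real.pi)) := by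
      congr 1; ext y
      have : (Real.pi : ℂ) ≠ 0 := by exact_mod_cast Real.pi_ne_zero
      rw [mul_assoc]
      congr 3
      push_cast; field_simp
    refine h1.trans ((Measure.integral_comp_div (fun t : ℝ => (BPc : ℂ) * ((𝓕 S) t * Complex.exp (2 * Real.pi * Complex.I * (t * ζ)))) (2 * Real.pi)).trans ?_)
    rw [integral_const_mul]
    have h2 : (𝓕⁻ (𝓕 S)) ζ = S ζ := by rw [FourierTransform.fourierInv_fourier_eq]
    rw [SchwartzMap.fourierInv_coe, Real.fourierInv_eq', hSa] at h2
    have h3 : ∫ t : ℝ, (𝓕 S) t * Complex.exp (2 * Real.pi * Complex.I * (t * ζ)) = σ ζ := by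
      rw [← h2]
      congr 1; ext t
      rw [smul_eq_mul, mul_comm]
      congr 2
      simp
      ring
    rw [h3, ← BPc_sq, abs_of_pos (by positivity), Complex.real_smul]
    push_cast; ring

/-! ### Vanishing of inadmissible interactions -/

lemma BP_triple {σ₁ σ₂ σ₃ : ℝ → ℝ} (h₁ : BPSym σ₁) (h₂ : BPSym σ₂) (h₃ : BPSym σ₃)
    (hz : ∀ ξ η, σ₁ (ξ + η) * (σ₂ ξ * σ₃ η) = 0) (a b : ℝ) :
    ∫ y : ℝ, invFourier σ₁ y * (invFourier σ₂ (a - y) * invFourier σ₃ (b - y)) = 0 := by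
  obtain ⟨c1, i1, f1⟩ := h₁.main
  set E : ℝ × ℝ × ℝ → ℂ := fun p => (invFourier σ₁ p.1 : ℂ) *
    ((Complex.exp (Complex.I * (((a - p.1 : ℝ) : ℂ) * p.2.1)) *
      Complex.exp (Complex.I * (((b - p.1 : ℝ) : ℂ) * p.2.2))) * ((σ₂ p.2.1 : ℂ) * (σ₃ p.2.2 : ℂ))) with hE
  have hint : Integrable E ((volume : Measure ℝ).prod ((volume : Measure ℝ).prod (volume : Measure ℝ))) := by
    have hb : Integrable (fun p : ℝ × ℝ × ℝ => (invFourier σ₁ p.1 : ℂ) *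
        ((σ₂ p.2.1 : ℂ) * (σ₃ p.2.2 : ℂ)))
        ((volume : Measure ℝ).prod ((volume : Measure ℝ).prod (volume : Measure ℝ))) :=
      Integrable.mul_prod (i1.ofReal (𝕜 := ℂ)) ((h₂.integrable.ofReal (𝕜 := ℂ)).mul_prod (h₃.integrable.ofReal (𝕜 := ℂ)))
    have := hb.bdd_mul (c := 1) (f := fun p : ℝ × ℝ × ℝ =>
        Complex.exp (Complex.I * (((a - p.1 : ℝ) : ℂ) * p.2.1)) *
        Complex.exp (Complex.I * (((b - p.1 : ℝ) : ℂ) * p.2.2)))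
        (by
          apply Continuous.aestronglyMeasurable
          fun_prop)
        (Filter.Eventually.of_forall fun p => by
          rw [norm_mul, Complex.norm_exp, Complex.norm_exp]; simp)
    refine this.congr (Filter.Eventually.of_forall fun p => ?_)
    simp only [hE]; ring
  have hswap := integral_integral_swap (f := fun y q => E (y, q)) hint
  have hL : ∀ y : ℝ, ∫ q : ℝ × ℝ, E (y, q) =
      (invFourier σ₁ y : ℂ) * ((∫ ξ : ℝ, Complex.exp (Complex.I * (((a - y : ℝ) : ℂ) * ξ)) * (σ₂ ξ : ℂ)) *
       ∫ ξ : ℝ, Complex.exp (Complex.I * (((b - y : ℝ) : ℂ) * ξ)) * (σ₃ ξ : ℂ)) := by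
    intro y
    rw [← integral_prod_mul, ← integral_const_mul]
    congr 1; ext q
    simp only [hE]; ring
  have hR : ∀ q : ℝ × ℝ, ∫ y : ℝ, E (y, q) = 0 := by
    intro q
    have e1 : ∀ y : ℝ, E (y, q) = (Complex.exp (Complex.I * (a * q.1 + b * q.2)) *
        ((σ₂ q.1 : ℂ) * (σ₃ q.2 : ℂ))) *
        ((invFourier σ₁ y : ℂ) * Complex.exp (Complex.I * (y * ((-(q.1 + q.2) : ℝ) : ℂ)))) := by
      intro y
      simp only [hE]
      have : Complex.exp (Complex.I * (((a - y : ℝ) : ℂ) * q.1)) *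
        Complex.exp (Complex.I * (((b - y : ℝ) : ℂ) * q.2)) =
        Complex.exp (Complex.I * (a * q.1 + b * q.2)) *
          Complex.exp (Complex.I * (y * ((-(q.1 + q.2) : ℝ) : ℂ))) := by
        rw [← Complex.exp_add, ← Complex.exp_add]
        congr 1
        push_cast; ring
      rw [this]; ring
    simp_rw [e1]
    rw [integral_const_mul, f1, h₁.even]
    have hz' : (σ₁ (q.1 + q.2) : ℂ) * ((σ₂ q.1 : ℂ) * (σ₃ q.2 : ℂ)) = 0 := by
      exact_mod_cast hz q.1 q.2
    linear_combination (Complex.exp (Complex.I * (a * q.1 + b * q.2)) *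
      (Real.sqrt (2 * Real.pi) : ℂ)) * hz'
  have hfin : ((∫ y : ℝ, invFourier σ₁ y * (invFourier σ₂ (a - y) * invFourier σ₃ (b - y)) : ℝ) : ℂ)
      = (BPc : ℂ) * BPc * ∫ y : ℝ, ∫ q : ℝ × ℝ, E (y, q) := by
    rw [← integral_complex_ofReal, ← integral_const_mul]
    congr 1; ext y
    rw [hL, Complex.ofReal_mul, Complex.ofReal_mul]
    rw [h₂.kernel_eq, h₃.kernel_eq]
    ring
  have hzero : ∫ y : ℝ, ∫ q : ℝ × ℝ, E (y, q) = 0 := by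
    refine hswap.trans ?_
    simp [hR]
  rw [hzero, mul_zero] at hfin
  exact_mod_cast hfin

lemma BP_vanish {K₁ K₂ K₃ f g : ℝ → ℝ} (c₁ : Continuous K₁) (c₂ : Continuous K₂)
    (c₃ : Continuous K₃) (i₁ : Integrable K₁) (i₂ : Integrable K₂) (i₃ : Integrable K₃)
    (hf : Continuous f) (hg : Continuous g) {A B : ℝ} (hA : ∀ x, |f x| ≤ A) (hB : ∀ x, |g x| ≤ B)
    (hz : ∀ a b, ∫ y : ℝ, K₁ y * (K₂ (a - y) * K₃ (b - y)) = 0) (x : ℝ) :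
    ∫ y : ℝ, K₁ y * ((∫ z : ℝ, K₂ z * f (x - y - z)) * ∫ w : ℝ, K₃ w * g (x - y - w)) = 0 := by
  have sh : ∀ (K h : ℝ → ℝ) (y : ℝ), ∫ z : ℝ, K z * h (x - y - z) = ∫ z : ℝ, K (z - y) * h (x - z) := by
    intro K h y
    rw [← integral_sub_right_eq_self (fun z => K z * h (x - y - z)) y]
    congr 1; ext z; congr 2; ring
  set E : ℝ × ℝ × ℝ → ℝ := fun p =>
    (f (x - p.2.1) * g (x - p.2.2)) * (K₁ p.1 * (K₂ (p.2.1 - p.1) * K₃ (p.2.2 - p.1))) with hE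
  have hb : Integrable (fun p : ℝ × ℝ × ℝ => K₁ p.1 * (K₂ (p.2.1 - p.1) * K₃ (p.2.2 - p.1)))
      ((volume : Measure ℝ).prod ((volume : Measure ℝ).prod (volume : Measure ℝ))) := by
    rw [integrable_prod_iff]
    · refine ⟨Filter.Eventually.of_forall fun y => ?_, ?_⟩
      · exact ((i₂.comp_sub_right y).mul_prod (i₃.comp_sub_right y)).const_mul (K₁ y)
      · have : ∀ y : ℝ, ∫ q : ℝ × ℝ, ‖K₁ y * (K₂ (q.1 - y) * K₃ (q.2 - y))‖ =
          ‖K₁ y‖ * ((∫ t, ‖K₂ t‖) * ∫ t, ‖K₃ t‖) := by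
          intro y
          rw [← integral_sub_right_eq_self (fun t => ‖K₂ t‖) y, ← integral_sub_right_eq_self (fun t => ‖K₃ t‖) y,
            ← integral_prod_mul, ← integral_const_mul]
          congr 1; ext q; rw [norm_mul, norm_mul]
        refine (i₁.norm.mul_const ((∫ t, ‖K₂ t‖) * ∫ t, ‖K₃ t‖)).congr
          (Filter.Eventually.of_forall fun y => (this y).symm)
    · apply Continuous.aestronglyMeasurable
      fun_prop
  have hint : Integrable E
      ((volume : Measure ℝ).prod ((volume : Measure ℝ).prod (volume : Measure ℝ))) := by
    refine hb.bdd_mul (c := A * B) ?_ (Filter.Eventually.of_forall fun p => ?_)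
    · apply Continuous.aestronglyMeasurable
      fun_prop
    · rw [norm_mul]
      exact mul_le_mul (hA _) (hB _) (norm_nonneg _) ((abs_nonneg _).trans (hA 0))
  have hswap := integral_integral_swap (f := fun y q => E (y, q)) hint
  have hR : ∀ q : ℝ × ℝ, ∫ y : ℝ, E (y, q) = 0 := by
    intro q
    simp only [hE]
    rw [integral_const_mul, hz, mul_zero]
  have hL : ∀ y : ℝ, ∫ q : ℝ × ℝ, E (y, q) =
      K₁ y * ((∫ z : ℝ, K₂ z * f (x - y - z)) * ∫ w : ℝ, K₃ w * g (x - y - w)) := by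
    intro y
    rw [sh, sh, ← integral_prod_mul, ← integral_const_mul]
    congr 1; ext q
    simp only [hE]; ring
  simp_rw [← hL]
  refine hswap.trans ?_
  simp [hR]

/-! ### The Littlewood–Paley kernels -/

def BPD (ρ : ℝ → ℝ) (n : ℕ) : ℝ → ℝ := invFourier (fun ξ => ρ (ξ / 2 ^ n))

lemma BP_sym_dil {ρ : ℝ → ℝ} (hρ : IsLPCutoff ρ) (n : ℕ) : BPSym (fun ξ => ρ (ξ / 2 ^ n)) where
  smooth := hρ.smooth.comp (contDiff_id.div_const _)
  even := fun ξ => by rw [neg_div, hρ.even]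
  supp := by
    refine HasCompactSupport.intro (isCompact_Icc (a := -(9 / 8 * 2 ^ n : ℝ)) (b := 9 / 8 * 2 ^ n)) ?_
    intro ξ hξ
    apply hρ.eq_zero
    rw [abs_div, abs_of_pos (by positivity : (0 : ℝ) < 2 ^ n), le_div_iff₀ (by positivity)]
    by_contra hc
    push Not at hc
    rw [abs_lt] at hc
    exact hξ ⟨hc.1.le, hc.2.le⟩

lemma lpSymbol_zero (ρ : ℝ → ℝ) : lpSymbol ρ 0 = fun ξ => ρ (ξ / 2 ^ 0) := by
  ext ξ; simp [lpSymbol]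

lemma lpSymbol_succ (ρ : ℝ → ℝ) (k : ℕ) :
    lpSymbol ρ (k + 1) = fun ξ => ρ (ξ / 2 ^ (k + 1)) - ρ (ξ / 2 ^ k) := by
  ext ξ
  simp only [lpSymbol]
  congr 2
  rw [pow_succ]; field_simp

lemma BP_sym_lp {ρ : ℝ → ℝ} (hρ : IsLPCutoff ρ) (k : ℕ) : BPSym (lpSymbol ρ k) := by
  cases k with
  | zero => rw [lpSymbol_zero]; exact BP_sym_dil hρ 0
  | succ k =>
    rw [lpSymbol_succ]
    have h1 := BP_sym_dil hρ (k + 1)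
    have h2 := BP_sym_dil hρ k
    exact ⟨h1.smooth.sub h2.smooth, fun ξ => by rw [h1.even, h2.even], h1.supp.sub h2.supp⟩

lemma lpKernel_zero (ρ : ℝ → ℝ) : lpKernel ρ 0 = BPD ρ 0 := by
  unfold lpKernel BPD; rw [lpSymbol_zero]

lemma lpKernel_succ {ρ : ℝ → ℝ} (hρ : IsLPCutoff ρ) (k : ℕ) (y : ℝ) :
    lpKernel ρ (k + 1) y = BPD ρ (k + 1) y - BPD ρ k y := by
  unfold lpKernel BPD invFourier
  rw [lpSymbol_succ, ← mul_sub, ← integral_sub]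
  · simp_rw [mul_sub]
  all_goals
    refine Integrable.bdd_mul (c := 1) (BP_sym_dil hρ _).integrable
      (by apply Continuous.aestronglyMeasurable; fun_prop)
      (Filter.Eventually.of_forall fun ξ => ?_)
    exact Real.abs_cos_le_one _

lemma BPD_sum {ρ : ℝ → ℝ} (hρ : IsLPCutoff ρ) (n : ℕ) (y : ℝ) :
    BPD ρ n y = ∑ k ∈ Finset.range (n + 1), lpKernel ρ k y := by
  induction n with
  | zero => simp [lpKernel_zero]
  | succ n ih => rw [Finset.sum_range_succ, ← ih, lpKernel_succ hρ]; ring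

lemma BPD_dil (ρ : ℝ → ℝ) (n : ℕ) (y : ℝ) :
    BPD ρ n y = 2 ^ n * BPD ρ 0 (2 ^ n * y) := by
  have hp : (0 : ℝ) < 2 ^ n := by positivity
  unfold BPD invFourier
  have h := Measure.integral_comp_div (fun ξ => Real.cos (2 ^ n * y * ξ) * ρ ξ) ((2 : ℝ) ^ n)
  have h2 : ∫ ξ : ℝ, Real.cos (y * ξ) * ρ (ξ / 2 ^ n) =
      ∫ ξ : ℝ, Real.cos (2 ^ n * y * (ξ / 2 ^ n)) * ρ (ξ / 2 ^ n) := by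
    congr 1; ext ξ; congr 2; field_simp
  rw [h2, h, abs_of_pos hp, smul_eq_mul]
  simp only [pow_zero, div_one]
  ring

lemma BPD_cont {ρ : ℝ → ℝ} (hρ : IsLPCutoff ρ) (n : ℕ) : Continuous (BPD ρ n) :=
  (BP_sym_dil hρ n).main.1

lemma BPD_int {ρ : ℝ → ℝ} (hρ : IsLPCutoff ρ) (n : ℕ) : Integrable (BPD ρ n) :=
  (BP_sym_dil hρ n).main.2.1

lemma lpK_cont {ρ : ℝ → ℝ} (hρ : IsLPCutoff ρ) (n : ℕ) : Continuous (lpKernel ρ n) :=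
  (BP_sym_lp hρ n).main.1

lemma lpK_int {ρ : ℝ → ℝ} (hρ : IsLPCutoff ρ) (n : ℕ) : Integrable (lpKernel ρ n) :=
  (BP_sym_lp hρ n).main.2.1

lemma BPD_total {ρ : ℝ → ℝ} (hρ : IsLPCutoff ρ) : ∫ y, BPD ρ 0 y = Real.sqrt (2 * Real.pi) := by
  have h := (BP_sym_dil hρ 0).main.2.2 0
  have h0 : ρ 0 = 1 := hρ.eq_one 0 (by norm_num)
  simp only [Complex.ofReal_zero, mul_zero, Complex.exp_zero, mul_one, zero_div, h0,
    Complex.ofReal_one] at h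
  rw [integral_complex_ofReal] at h
  exact Complex.ofReal_injective h

def BPL (ρ : ℝ → ℝ) : ℝ := ∫ y, ‖BPD ρ 0 y‖

lemma BPL_nonneg (ρ : ℝ → ℝ) : 0 ≤ BPL ρ := integral_nonneg fun _ => norm_nonneg _

lemma BPD_L1 (ρ : ℝ → ℝ) (n : ℕ) : ∫ y, ‖BPD ρ n y‖ = BPL ρ := by
  have hp : (0 : ℝ) < 2 ^ n := by positivity
  have : ∀ y, ‖BPD ρ n y‖ = 2 ^ n * ‖BPD ρ 0 (2 ^ n * y)‖ := by
    intro y; rw [BPD_dil, norm_mul, Real.norm_of_nonneg hp.le]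
  simp_rw [this]
  rw [integral_const_mul, Measure.integral_comp_mul_left (fun y => ‖BPD ρ 0 y‖), abs_of_pos (by positivity),
    smul_eq_mul]
  unfold BPL; field_simp

lemma lpK_L1 {ρ : ℝ → ℝ} (hρ : IsLPCutoff ρ) (k : ℕ) : ∫ y, ‖lpKernel ρ k y‖ ≤ 2 * BPL ρ := by
  have h0 := BPL_nonneg ρ
  cases k with
  | zero => rw [lpKernel_zero, BPD_L1]; linarith
  | succ k =>
    have : ∫ y, ‖lpKernel ρ (k + 1) y‖ ≤ ∫ y, (‖BPD ρ (k + 1) y‖ + ‖BPD ρ k y‖) := by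
      refine integral_mono (lpK_int hρ _).norm ((BPD_int hρ _).norm.add (BPD_int hρ _).norm) fun y => ?_
      simp only []
      rw [lpKernel_succ hρ]
      exact norm_sub_le _ _
    rw [integral_add (BPD_int hρ _).norm (BPD_int hρ _).norm, BPD_L1, BPD_L1] at this
    linarith

/-! ### Admissible frequency triples -/

def BPAdm (k m l : ℕ) : Prop := k ≤ max m l + 2 ∧ m ≤ max k l + 2 ∧ l ≤ max k m + 2

lemma lpSymbol_supp {ρ : ℝ → ℝ} (hρ : IsLPCutoff ρ) (k : ℕ) (ξ : ℝ) (h : lpSymbol ρ k ξ ≠ 0) :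
    |ξ| ≤ 9 / 8 * 2 ^ k ∧ (k = 0 ∨ 7 / 16 * 2 ^ k ≤ |ξ|) := by
  have hb : ∀ n : ℕ, 9 / 8 * 2 ^ n < |ξ| → ρ (ξ / 2 ^ n) = 0 := by
    intro n hn
    apply hρ.eq_zero
    rw [abs_div, abs_of_pos (by positivity : (0 : ℝ) < 2 ^ n), le_div_iff₀ (by positivity)]
    exact hn.le
  have hs : ∀ n : ℕ, |ξ| ≤ 7 / 8 * 2 ^ n → ρ (ξ / 2 ^ n) = 1 := by
    intro n hn
    apply hρ.eq_one
    rw [abs_div, abs_of_pos (by positivity : (0 : ℝ) < 2 ^ n), div_le_iff₀ (by positivity)]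
    exact hn
  cases k with
  | zero =>
    rw [lpSymbol_zero] at h
    refine ⟨?_, Or.inl rfl⟩
    by_contra hc
    exact h (hb 0 (not_le.mp hc))
  | succ k =>
    rw [lpSymbol_succ] at h
    have hp : (0 : ℝ) < 2 ^ k := by positivity
    have hpe : (2 : ℝ) ^ (k + 1) = 2 * 2 ^ k := by ring
    refine ⟨?_, Or.inr ?_⟩
    · by_contra hc
      push Not at hc
      apply h
      simp only []
      rw [hb _ hc, hb k (by rw [hpe] at hc; linarith), sub_zero]
    · by_contra hc
      push Not at hc
      apply h
      simp only []
      rw [hs (k + 1) (by rw [hpe] at hc ⊢; linarith), hs k (by rw [hpe] at hc; linarith), sub_self]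

lemma BP_freq {a b c : ℝ} {k m l : ℕ} (h : |a| ≤ |b| + |c|) (ha : k = 0 ∨ 7 / 16 * 2 ^ k ≤ |a|)
    (hb : |b| ≤ 9 / 8 * 2 ^ m) (hc : |c| ≤ 9 / 8 * 2 ^ l) : k ≤ max m l + 2 := by
  rcases ha with ha | ha
  · omega
  by_contra hcon
  have hk : max m l + 3 ≤ k := by omega
  have h1 : (2 : ℝ) ^ (max m l + 3) ≤ 2 ^ k := pow_le_pow_right₀ (by norm_num) hk
  have h2 : (2 : ℝ) ^ m ≤ 2 ^ (max m l) := pow_le_pow_right₀ (by norm_num) (le_max_left _ _)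
  have h3 : (2 : ℝ) ^ l ≤ 2 ^ (max m l) := pow_le_pow_right₀ (by norm_num) (le_max_right _ _)
  have h4 : (0 : ℝ) < 2 ^ (max m l) := by positivity
  rw [pow_add] at h1
  linarith

lemma BP_symbol_zero {ρ : ℝ → ℝ} (hρ : IsLPCutoff ρ) {k m l : ℕ} (h : ¬ BPAdm k m l) (ξ η : ℝ) :
    lpSymbol ρ k (ξ + η) * (lpSymbol ρ m ξ * lpSymbol ρ l η) = 0 := by
  by_contra hne
  have h1 : lpSymbol ρ k (ξ + η) ≠ 0 := fun h0 => hne (by rw [h0, zero_mul])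
  have h2 : lpSymbol ρ m ξ ≠ 0 := fun h0 => hne (by rw [h0]; ring)
  have h3 : lpSymbol ρ l η ≠ 0 := fun h0 => hne (by rw [h0]; ring)
  obtain ⟨u1, v1⟩ := lpSymbol_supp hρ _ _ h1
  obtain ⟨u2, v2⟩ := lpSymbol_supp hρ _ _ h2
  obtain ⟨u3, v3⟩ := lpSymbol_supp hρ _ _ h3
  refine h ⟨BP_freq (abs_add_le _ _) v1 u2 u3, BP_freq ?_ v2 u1 u3, BP_freq ?_ v3 u1 u2⟩
  · have := abs_sub (ξ + η) η
    simpa using this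
  · have := abs_sub (ξ + η) ξ
    simpa using this

/-! ### Convolution operators in one of two variables -/

structure BPB (H : ℝ × ℝ → ℝ) (M : ℝ) : Prop where
  cont : Continuous H
  bd : ∀ p, |H p| ≤ M

lemma BPB.nonneg {H : ℝ × ℝ → ℝ} {M : ℝ} (h : BPB H M) : 0 ≤ M := (abs_nonneg _).trans (h.bd 0)

def BPu (K : ℝ → ℝ) (H : ℝ × ℝ → ℝ) (p : ℝ × ℝ) : ℝ := ∫ y : ℝ, K y * H (p.1 - y, p.2)
def BPv (K : ℝ → ℝ) (H : ℝ × ℝ → ℝ) (p : ℝ × ℝ) : ℝ := ∫ y : ℝ, K y * H (p.1, p.2 - y)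

lemma LPu_eq (ρ : ℝ → ℝ) (k : ℕ) (H : ℝ × ℝ → ℝ) : LPu ρ k H = BPu (lpKernel ρ k) H := rfl
lemma LPv_eq (ρ : ℝ → ℝ) (k : ℕ) (H : ℝ × ℝ → ℝ) : LPv ρ k H = BPv (lpKernel ρ k) H := rfl

lemma BPv_swap (K : ℝ → ℝ) (H : ℝ × ℝ → ℝ) (p : ℝ × ℝ) :
    BPv K H p = BPu K (fun q => H q.swap) p.swap := rfl

lemma BPB.swap {H : ℝ × ℝ → ℝ} {M : ℝ} (h : BPB H M) : BPB (fun q => H q.swap) M :=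
  ⟨h.cont.comp continuous_swap, fun p => h.bd _⟩

lemma BPB.integrable {H : ℝ × ℝ → ℝ} {M : ℝ} (h : BPB H M) {K : ℝ → ℝ} (hK : Integrable K)
    (p : ℝ × ℝ) : Integrable (fun y => K y * H (p.1 - y, p.2)) := by
  have := h.cont
  refine hK.mul_bdd (c := M) ?_ (Filter.Eventually.of_forall fun y => h.bd _)
  apply Continuous.aestronglyMeasurable
  fun_prop

lemma BPB.u {H : ℝ × ℝ → ℝ} {M : ℝ} (h : BPB H M) {K : ℝ → ℝ} (hK : Integrable K) :
    BPB (BPu K H) ((∫ y, ‖K y‖) * M) := by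
  have hc := h.cont
  have hb : ∀ p : ℝ × ℝ, ∀ y, ‖K y * H (p.1 - y, p.2)‖ ≤ ‖K y‖ * M := by
    intro p y
    rw [norm_mul]
    exact mul_le_mul_of_nonneg_left (h.bd _) (norm_nonneg _)
  constructor
  · unfold BPu
    refine continuous_of_dominated (bound := fun y => ‖K y‖ * M)
      (fun p => (h.integrable hK p).aestronglyMeasurable)
      (fun p => Filter.Eventually.of_forall (hb p)) (hK.norm.mul_const _)
      (Filter.Eventually.of_forall fun y => ?_)
    fun_prop
  · intro p
    rw [← integral_mul_const]
    exact norm_integral_le_of_norm_le (hK.norm.mul_const M) (Filter.Eventually.of_forall (hb p))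

lemma BPB.v {H : ℝ × ℝ → ℝ} {M : ℝ} (h : BPB H M) {K : ℝ → ℝ} (hK : Integrable K) :
    BPB (BPv K H) ((∫ y, ‖K y‖) * M) := (h.swap.u hK).swap

lemma BPB.mul {H G : ℝ × ℝ → ℝ} {M N : ℝ} (h : BPB H M) (g : BPB G N) :
    BPB (fun p => H p * G p) (M * N) :=
  ⟨h.cont.mul g.cont, fun p => by
    rw [abs_mul]; exact mul_le_mul (h.bd _) (g.bd _) (abs_nonneg _) h.nonneg⟩

lemma BPu_enorm {K : ℝ → ℝ} (hK : Integrable K) {H : ℝ × ℝ → ℝ} {A : ℝ≥0∞}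
    (hA : ∀ p, ‖H p‖ₑ ≤ A) {L : ℝ} (hL : ∫ y, ‖K y‖ ≤ L) (p : ℝ × ℝ) :
    ‖BPu K H p‖ₑ ≤ ENNReal.ofReal L * A := by
  unfold BPu
  calc ‖∫ y : ℝ, K y * H (p.1 - y, p.2)‖ₑ ≤ ∫⁻ y, ‖K y * H (p.1 - y, p.2)‖ₑ :=
        enorm_integral_le_lintegral_enorm _
    _ ≤ ∫⁻ y, ‖K y‖ₑ * A := by
        refine lintegral_mono fun y => ?_
        rw [enorm_mul]
        gcongr
        exact hA _
    _ = (∫⁻ y, ‖K y‖ₑ) * A := lintegral_mul_const'' _ hK.aestronglyMeasurable.enorm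
    _ ≤ _ := by
        rw [← ofReal_integral_norm_eq_lintegral_enorm hK]
        gcongr

lemma BPv_enorm {K : ℝ → ℝ} (hK : Integrable K) {H : ℝ × ℝ → ℝ} {A : ℝ≥0∞}
    (hA : ∀ p, ‖H p‖ₑ ≤ A) {L : ℝ} (hL : ∫ y, ‖K y‖ ≤ L) (p : ℝ × ℝ) :
    ‖BPv K H p‖ₑ ≤ ENNReal.ofReal L * A :=
  BPu_enorm hK (fun q => hA q.swap) hL p.swap

lemma BP_comm {K L : ℝ → ℝ} (hK : Integrable K) (hL : Integrable L) {H : ℝ × ℝ → ℝ} {M : ℝ}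
    (h : BPB H M) : BPu K (BPv L H) = BPv L (BPu K H) := by
  ext p
  have hc := h.cont
  unfold BPu BPv
  simp only []
  have hint : Integrable (fun q : ℝ × ℝ => (K q.1 * L q.2) * H (p.1 - q.1, p.2 - q.2))
      ((volume : Measure ℝ).prod (volume : Measure ℝ)) := by
    refine (hK.mul_prod hL).mul_bdd (c := M) ?_ (Filter.Eventually.of_forall fun y => h.bd _)
    apply Continuous.aestronglyMeasurable
    fun_prop
  have hs := integral_integral_swap (f := fun y z => (K y * L z) * H (p.1 - y, p.2 - z)) hint
  simp_rw [← integral_const_mul]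
  have e1 : ∀ y z : ℝ, K y * (L z * H (p.1 - y, p.2 - z)) = (K y * L z) * H (p.1 - y, p.2 - z) :=
    fun y z => by ring
  have e2 : ∀ y z : ℝ, L z * (K y * H (p.1 - y, p.2 - z)) = (K y * L z) * H (p.1 - y, p.2 - z) :=
    fun y z => by ring
  simp_rw [e1, e2]
  exact hs

lemma BPu_tendsto {K : ℝ → ℝ} (hK : Integrable K) {H : ℕ → ℝ × ℝ → ℝ} {H' : ℝ × ℝ → ℝ} {M : ℝ}
    (h : ∀ n, BPB (H n) M) (ht : ∀ p, Filter.Tendsto (fun n => H n p) Filter.atTop (nhds (H' p)))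
    (p : ℝ × ℝ) : Filter.Tendsto (fun n => BPu K (H n) p) Filter.atTop (nhds (BPu K H' p)) := by
  unfold BPu
  refine tendsto_integral_of_dominated_convergence (fun y => ‖K y‖ * M)
    (fun n => ((h n).integrable hK p).aestronglyMeasurable) (hK.norm.mul_const _)
    (fun n => Filter.Eventually.of_forall fun y => ?_)
    (Filter.Eventually.of_forall fun y => (ht _).const_mul _)
  rw [norm_mul]
  exact mul_le_mul_of_nonneg_left ((h n).bd _) (norm_nonneg _)

lemma BPv_tendsto {K : ℝ → ℝ} (hK : Integrable K) {H : ℕ → ℝ × ℝ → ℝ} {H' : ℝ × ℝ → ℝ} {M : ℝ}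
    (h : ∀ n, BPB (H n) M) (ht : ∀ p, Filter.Tendsto (fun n => H n p) Filter.atTop (nhds (H' p)))
    (p : ℝ × ℝ) : Filter.Tendsto (fun n => BPv K (H n) p) Filter.atTop (nhds (BPv K H' p)) :=
  BPu_tendsto hK (fun n => (h n).swap) (fun q => ht q.swap) p.swap

lemma BPu_sum {ι : Type*} (s : Finset ι) {K : ℝ → ℝ} (hK : Integrable K) {H : ι → ℝ × ℝ → ℝ}
    (h : ∀ i, ∃ M, BPB (H i) M) :
    BPu K (fun p => ∑ i ∈ s, H i p) = fun p => ∑ i ∈ s, BPu K (H i) p := by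
  ext p
  unfold BPu
  simp_rw [Finset.mul_sum]
  refine integral_finsetSum _ fun i _ => ?_
  obtain ⟨M, hM⟩ := h i
  exact hM.integrable hK p

lemma BPv_sum {ι : Type*} (s : Finset ι) {K : ℝ → ℝ} (hK : Integrable K) {H : ι → ℝ × ℝ → ℝ}
    (h : ∀ i, ∃ M, BPB (H i) M) :
    BPv K (fun p => ∑ i ∈ s, H i p) = fun p => ∑ i ∈ s, BPv K (H i) p := by
  ext p
  exact congrFun (BPu_sum s hK (H := fun i q => H i q.swap)
    (fun i => let ⟨M, hM⟩ := h i; ⟨M, hM.swap⟩)) p.swap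

lemma BPu_ksum {ι : Type*} (s : Finset ι) {K : ι → ℝ → ℝ} (hK : ∀ i, Integrable (K i))
    {H : ℝ × ℝ → ℝ} {M : ℝ} (h : BPB H M) :
    BPu (fun y => ∑ i ∈ s, K i y) H = fun p => ∑ i ∈ s, BPu (K i) H p := by
  ext p
  unfold BPu
  simp_rw [Finset.sum_mul]
  exact integral_finsetSum _ fun i _ => h.integrable (hK i) p

lemma BPv_ksum {ι : Type*} (s : Finset ι) {K : ι → ℝ → ℝ} (hK : ∀ i, Integrable (K i))
    {H : ℝ × ℝ → ℝ} {M : ℝ} (h : BPB H M) :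
    BPv (fun y => ∑ i ∈ s, K i y) H = fun p => ∑ i ∈ s, BPv (K i) H p := by
  ext p
  exact congrFun (BPu_ksum s hK h.swap) p.swap

/-! ### Approximate identity -/

lemma BPD_u (ρ : ℝ → ℝ) (n : ℕ) (H : ℝ × ℝ → ℝ) (p : ℝ × ℝ) :
    BPu (BPD ρ n) H p = ∫ z, BPD ρ 0 z * H (p.1 - z / 2 ^ n, p.2) := by
  have hp : (0 : ℝ) < 2 ^ n := by positivity
  unfold BPu
  have h := Measure.integral_comp_mul_left (fun z => BPD ρ 0 z * H (p.1 - z / 2 ^ n, p.2)) ((2 : ℝ) ^ n)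
  have e : ∀ y, BPD ρ n y * H (p.1 - y, p.2)
      = 2 ^ n * (BPD ρ 0 (2 ^ n * y) * H (p.1 - 2 ^ n * y / 2 ^ n, p.2)) := by
    intro y
    rw [BPD_dil, mul_div_cancel_left₀ _ hp.ne']; ring
  simp_rw [e]
  rw [integral_const_mul, h, abs_of_pos (by positivity), smul_eq_mul]
  field_simp

lemma BPD_v (ρ : ℝ → ℝ) (n : ℕ) (H : ℝ × ℝ → ℝ) (p : ℝ × ℝ) :
    BPv (BPD ρ n) H p = ∫ z, BPD ρ 0 z * H (p.1, p.2 - z / 2 ^ n) :=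
  BPD_u ρ n (fun q => H q.swap) p.swap

lemma BP_div_tendsto (x z : ℝ) :
    Filter.Tendsto (fun n : ℕ => x - z / 2 ^ n) Filter.atTop (nhds x) := by
  have h : Filter.Tendsto (fun n : ℕ => z / (2 : ℝ) ^ n) Filter.atTop (nhds 0) :=
    tendsto_const_nhds.div_atTop (tendsto_pow_atTop_atTop_of_one_lt (by norm_num))
  simpa using tendsto_const_nhds.sub h

lemma BP_approx {ρ : ℝ → ℝ} (hρ : IsLPCutoff ρ) {F : ℝ × ℝ → ℝ} {M : ℝ} (h : BPB F M) (p : ℝ × ℝ) :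
    Filter.Tendsto (fun n => BPu (BPD ρ n) (BPv (BPD ρ n) F) p) Filter.atTop
      (nhds (2 * Real.pi * F p)) := by
  have hc := h.cont
  have i0 := BPD_int hρ 0
  have hL := BPL_nonneg ρ
  have key : ∀ (H : ℕ → ℝ → ℝ) (c N : ℝ), (∀ n, Continuous (H n)) → (∀ n z, |H n z| ≤ N) →
      (∀ z, Filter.Tendsto (fun n => H n z) Filter.atTop (nhds c)) →
      Filter.Tendsto (fun n => ∫ z, BPD ρ 0 z * H n z) Filter.atTop
        (nhds (Real.sqrt (2 * Real.pi) * c)) := by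
    intro H c N h1 h2 h3
    rw [← BPD_total hρ, ← integral_mul_const]
    refine tendsto_integral_of_dominated_convergence (fun y => ‖BPD ρ 0 y‖ * N)
      (fun n => i0.aestronglyMeasurable.mul (h1 n).aestronglyMeasurable) (i0.norm.mul_const _)
      (fun n => Filter.Eventually.of_forall fun y => ?_)
      (Filter.Eventually.of_forall fun y => (h3 _).const_mul _)
    rw [norm_mul]
    exact mul_le_mul_of_nonneg_left (h2 n y) (norm_nonneg _)
  have e : 2 * Real.pi * F p = Real.sqrt (2 * Real.pi) * (Real.sqrt (2 * Real.pi) * F p) := by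
    rw [← mul_assoc, Real.mul_self_sqrt (by positivity)]
  rw [e]
  simp_rw [BPD_u]
  have hB : ∀ n, BPB (BPv (BPD ρ n) F) (BPL ρ * M) := by
    intro n
    have := h.v (BPD_int hρ n)
    rwa [BPD_L1] at this
  refine key (fun n z => BPv (BPD ρ n) F (p.1 - z / 2 ^ n, p.2)) _ (BPL ρ * M) ?_ ?_ ?_
  · intro n
    have := (hB n).cont
    fun_prop
  · intro n z
    exact (hB n).bd _
  · intro z
    simp_rw [BPD_v]
    refine key (fun n w => F (p.1 - z / 2 ^ n, p.2 - w / 2 ^ n)) _ M ?_ ?_ ?_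
    · intro n
      fun_prop
    · intro n w
      exact h.bd _
    · intro w
      exact (hc.tendsto p).comp ((BP_div_tendsto p.1 z).prodMk_nhds (BP_div_tendsto p.2 w))

/-! ### Summation over admissible triples -/

def BPw (ε : ℝ) (a b : ℕ) : ℝ := (2 : ℝ) ^ (-(ε * |(a : ℝ) - b|))

lemma BPw_nonneg (ε : ℝ) (a b : ℕ) : 0 ≤ BPw ε a b := by unfold BPw; positivity

lemma BPw_sum {ε : ℝ} (hε : 0 < ε) : ∃ Q : ℝ, 0 ≤ Q ∧ ∀ n b : ℕ,
    ∑ a ∈ Finset.range n, BPw ε a b ≤ Q := by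
  set q : ℝ := (2 : ℝ) ^ (-ε) with hq
  have q0 : 0 < q := by positivity
  have q1 : q < 1 := Real.rpow_lt_one_of_one_lt_of_neg (by norm_num) (by linarith)
  have hgeo : ∀ n : ℕ, ∑ i ∈ Finset.range n, q ^ i ≤ (1 - q)⁻¹ := fun n =>
    (Summable.sum_le_tsum _ (fun i _ => by positivity)
      (summable_geometric_of_lt_one q0.le q1)).trans (tsum_geometric_of_lt_one q0.le q1).le
  have hw : ∀ (a b j : ℕ), |(a : ℝ) - b| = j → BPw ε a b = q ^ j := by
    intro a b j h
    unfold BPw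
    rw [h, hq, ← Real.rpow_natCast, ← Real.rpow_mul (by norm_num)]
    congr 1; ring
  refine ⟨2 * (1 - q)⁻¹, by have : 0 < (1 - q)⁻¹ := inv_pos.mpr (by linarith)
                            linarith, fun n b => ?_⟩
  calc ∑ a ∈ Finset.range n, BPw ε a b ≤ ∑ a ∈ Finset.range (b + n), BPw ε a b :=
        Finset.sum_le_sum_of_subset_of_nonneg (Finset.range_mono (by omega))
          fun a _ _ => BPw_nonneg _ _ _
    _ = ∑ a ∈ Finset.range b, BPw ε a b + ∑ i ∈ Finset.range n, BPw ε (b + i) b :=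
        Finset.sum_range_add _ _ _
    _ ≤ (1 - q)⁻¹ + (1 - q)⁻¹ := by
        refine add_le_add ?_ ?_
        · rw [← Finset.sum_range_reflect]
          refine le_trans (Finset.sum_le_sum fun j hj => ?_) (hgeo b)
          have hj' := Finset.mem_range.mp hj
          rw [hw _ _ (j + 1)]
          · exact pow_le_pow_of_le_one q0.le q1.le (Nat.le_succ j)
          · have : ((b - 1 - j : ℕ) : ℝ) = b - 1 - j := by
              rw [Nat.cast_sub (by omega), Nat.cast_sub (by omega)]; simp
            rw [this, abs_of_nonpos (by have : (0:ℝ) ≤ j := by positivity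
                                        linarith)]
            push_cast; ring
        · refine le_trans (Finset.sum_le_sum fun j _ => ?_) (hgeo n)
          rw [hw _ _ j]
          push_cast
          simp
    _ = _ := by ring

lemma BP_exp_A {α β γ ε k m l : ℝ} (hβ : β ≠ 0) (h1 : γ ≤ α) (h2 : γ ≤ β)
    (hab : 0 < α + β) (hε : 0 < ε) (hεβ : ε ≤ |β|) (hk : 0 ≤ k) (hl : 0 ≤ l)
    (hlk : l ≤ k) (hmk : |m - k| ≤ 2) :
    -(α * m) - β * l + γ * k ≤ 2 * |α| + 2 * ε - ε * |m - k| - ε * |l - 0| ∨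
    -(α * m) - β * l + γ * k ≤ 2 * |α| + 2 * ε - ε * |m - k| - ε * |l - k| := by
  have ha : -(α * (m - k)) ≤ 2 * |α| := by
    have : |α * (m - k)| ≤ |α| * 2 := by
      rw [abs_mul]; exact mul_le_mul_of_nonneg_left hmk (abs_nonneg _)
    linarith [neg_abs_le (α * (m - k))]
  have he : ε * |m - k| ≤ ε * 2 := mul_le_mul_of_nonneg_left hmk hε.le
  rcases lt_or_gt_of_ne hβ with hb | hb
  · right
    rw [abs_of_neg hb] at hεβ
    rw [abs_of_nonpos (by linarith : l - k ≤ 0)]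
    have h3 : (γ - α) * k ≤ β * k := mul_le_mul_of_nonneg_right (by linarith) hk
    have h4 : ε * (k - l) ≤ -β * (k - l) := mul_le_mul_of_nonneg_right hεβ (by linarith)
    linarith
  · left
    rw [abs_of_pos hb] at hεβ
    rw [sub_zero, abs_of_nonneg hl]
    have h3 : (γ - α) * k ≤ 0 := mul_nonpos_of_nonpos_of_nonneg (by linarith) hk
    have h4 : ε * l ≤ β * l := mul_le_mul_of_nonneg_right hεβ hl
    linarith

lemma BP_exp_C {α β γ ε k m l : ℝ} (h1 : γ ≤ α) (h2 : γ ≤ β)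
    (hab : 0 < α + β) (hε : 0 < ε) (hεab : ε ≤ α + β) (hk : 0 ≤ k)
    (hkm : k ≤ m) (hml : |l - m| ≤ 2) :
    -(α * m) - β * l + γ * k ≤ 2 * |β| + 2 * ε - ε * |m - k| - ε * |l - m| := by
  have ha : -(β * (l - m)) ≤ 2 * |β| := by
    have : |β * (l - m)| ≤ |β| * 2 := by
      rw [abs_mul]; exact mul_le_mul_of_nonneg_left hml (abs_nonneg _)
    linarith [neg_abs_le (β * (l - m))]
  have he : ε * |l - m| ≤ ε * 2 := mul_le_mul_of_nonneg_left hml hε.le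
  rw [abs_of_nonneg (by linarith : 0 ≤ m - k)]
  have hg : γ ≤ α + β := by
    rcases le_total 0 α with h | h <;> linarith
  have h3 : γ * k ≤ (α + β) * k := mul_le_mul_of_nonneg_right hg hk
  have h4 : ε * (m - k) ≤ (α + β) * (m - k) := mul_le_mul_of_nonneg_right hεab (by linarith)
  linarith

lemma BP_term {α β γ ε : ℝ} (hα : α ≠ 0) (hβ : β ≠ 0) (h1 : γ ≤ α) (h2 : γ ≤ β)
    (hab : 0 < α + β) (hε : 0 < ε) (hεα : ε ≤ |α|) (hεβ : ε ≤ |β|) (hεab : ε ≤ α + β)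
    {k m l : ℕ} (h : BPAdm k m l) :
    (2 : ℝ) ^ (-(α * m) - β * l + γ * k) ≤ (2 : ℝ) ^ (2 * |α| + 2 * |β| + 2 * ε) *
      (BPw ε m k * BPw ε l 0 + BPw ε m k * BPw ε l k + BPw ε l k * BPw ε m 0 + BPw ε l k * BPw ε m k
        + BPw ε m k * BPw ε l m) := by
  obtain ⟨a1, a2, a3⟩ := h
  have gen : ∀ x y : ℝ, -(α * m) - β * l + γ * k ≤ 2 * |α| + 2 * |β| + 2 * ε - ε * x - ε * y →
      (2 : ℝ) ^ (-(α * m) - β * l + γ * k) ≤ (2 : ℝ) ^ (2 * |α| + 2 * |β| + 2 * ε) *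
        ((2 : ℝ) ^ (-(ε * x)) * (2 : ℝ) ^ (-(ε * y))) := by
    intro x y hxy
    rw [← Real.rpow_add (by norm_num), ← Real.rpow_add (by norm_num)]
    refine Real.rpow_le_rpow_of_exponent_le (by norm_num) ?_
    linarith
  have p1 := mul_nonneg (BPw_nonneg ε m k) (BPw_nonneg ε l 0)
  have p2 := mul_nonneg (BPw_nonneg ε m k) (BPw_nonneg ε l k)
  have p3 := mul_nonneg (BPw_nonneg ε l k) (BPw_nonneg ε m 0)
  have p4 := mul_nonneg (BPw_nonneg ε l k) (BPw_nonneg ε m k)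
  have p5 := mul_nonneg (BPw_nonneg ε m k) (BPw_nonneg ε l m)
  have gen' : ∀ (a b c d : ℕ),
      -(α * m) - β * l + γ * k ≤ 2 * |α| + 2 * |β| + 2 * ε - ε * |(a : ℝ) - b| - ε * |(c : ℝ) - d| →
      BPw ε a b * BPw ε c d ≤ (BPw ε m k * BPw ε l 0 + BPw ε m k * BPw ε l k + BPw ε l k * BPw ε m 0
        + BPw ε l k * BPw ε m k + BPw ε m k * BPw ε l m) →
      (2 : ℝ) ^ (-(α * m) - β * l + γ * k) ≤ (2 : ℝ) ^ (2 * |α| + 2 * |β| + 2 * ε) *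
      (BPw ε m k * BPw ε l 0 + BPw ε m k * BPw ε l k + BPw ε l k * BPw ε m 0 + BPw ε l k * BPw ε m k
        + BPw ε m k * BPw ε l m) := by
    intro a b c d hh hs
    exact (gen _ _ hh).trans (mul_le_mul_of_nonneg_left hs (by positivity))
  have c0 : ∀ a : ℕ, (0 : ℝ) ≤ a := fun a => Nat.cast_nonneg a
  have hd : ∀ a b : ℕ, a ≤ b + 2 → b ≤ a + 2 → |(a : ℝ) - b| ≤ 2 := by
    intro a b u v
    have u' : (a : ℝ) ≤ b + 2 := by exact_mod_cast u
    have v' : (b : ℝ) ≤ a + 2 := by exact_mod_cast v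
    rw [abs_le]; constructor <;> linarith
  have nα := abs_nonneg α
  have nβ := abs_nonneg β
  by_cases hA : l ≤ m ∧ l ≤ k
  · rcases BP_exp_A (α := α) (m := m) hβ h1 h2 hab hε hεβ (c0 k) (c0 l)
      (by exact_mod_cast hA.2) (hd m k (by omega) (by omega)) with h | h
    · exact gen' m k l 0 (by push_cast; linarith) (by linarith)
    · exact gen' m k l k (by linarith) (by linarith)
  by_cases hB : m ≤ l ∧ m ≤ k
  · rcases BP_exp_A (α := β) (m := l) hα h2 h1 (by linarith) hε hεα (c0 k) (c0 m)
      (by exact_mod_cast hB.2) (hd l k (by omega) (by omega)) with h | h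
    · exact gen' l k m 0 (by push_cast; linarith) (by linarith)
    · exact gen' l k m k (by linarith) (by linarith)
  have h := BP_exp_C (α := α) (β := β) (k := k) (m := m) (l := l) h1 h2 hab hε hεab (c0 k)
      (by have : k ≤ m := by omega
          exact_mod_cast this) (hd l m (by omega) (by omega))
  exact gen' m k l m (by linarith) (by linarith)

def BPt (α β : ℝ) (k m l : ℕ) : ℝ := if BPAdm k m l then (2 : ℝ) ^ (-(α * m) - β * l) else 0

lemma BPt_nonneg (α β : ℝ) (k m l : ℕ) : 0 ≤ BPt α β k m l := by
  unfold BPt; split_ifs <;> positivity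

lemma BP_comb {α β γ : ℝ} (hα : α ≠ 0) (hβ : β ≠ 0) (hγ : γ ≤ min α β) (hab : 0 < α + β) :
    ∃ C : ℝ, 0 ≤ C ∧ ∀ k n : ℕ, (2 : ℝ) ^ (γ * k) *
      ∑ m ∈ Finset.range n, ∑ l ∈ Finset.range n, BPt α β k m l ≤ C := by
  set ε := min (min |α| |β|) (α + β) with hεd
  have hε : 0 < ε := lt_min (lt_min (abs_pos.mpr hα) (abs_pos.mpr hβ)) hab
  have e1 : ε ≤ |α| := (min_le_left _ _).trans (min_le_left _ _)
  have e2 : ε ≤ |β| := (min_le_left _ _).trans (min_le_right _ _)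
  have e3 : ε ≤ α + β := min_le_right _ _
  obtain ⟨Q, hQ0, hQ⟩ := BPw_sum hε
  set c := (2 : ℝ) ^ (2 * |α| + 2 * |β| + 2 * ε) with hc
  have hc0 : 0 ≤ c := by positivity
  refine ⟨c * (5 * Q ^ 2), by positivity, fun k n => ?_⟩
  have hterm : ∀ m l : ℕ, (2 : ℝ) ^ (γ * k) * BPt α β k m l ≤ c *
      (BPw ε m k * BPw ε l 0 + BPw ε m k * BPw ε l k + BPw ε l k * BPw ε m 0 + BPw ε l k * BPw ε m k
        + BPw ε m k * BPw ε l m) := by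
    intro m l
    have p1 := mul_nonneg (BPw_nonneg ε m k) (BPw_nonneg ε l 0)
    have p2 := mul_nonneg (BPw_nonneg ε m k) (BPw_nonneg ε l k)
    have p3 := mul_nonneg (BPw_nonneg ε l k) (BPw_nonneg ε m 0)
    have p4 := mul_nonneg (BPw_nonneg ε l k) (BPw_nonneg ε m k)
    have p5 := mul_nonneg (BPw_nonneg ε m k) (BPw_nonneg ε l m)
    unfold BPt
    split_ifs with h
    · rw [← Real.rpow_add (by norm_num), add_comm]
      exact BP_term hα hβ (hγ.trans (min_le_left _ _)) (hγ.trans (min_le_right _ _)) hab hε e1 e2 e3 h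
    · rw [mul_zero]
      exact mul_nonneg hc0 (by linarith)
  rw [Finset.mul_sum]
  simp_rw [Finset.mul_sum]
  refine (Finset.sum_le_sum fun m _ => Finset.sum_le_sum fun l _ => hterm m l).trans ?_
  simp_rw [← Finset.mul_sum]
  refine mul_le_mul_of_nonneg_left ?_ hc0
  have hm : ∀ m : ℕ, ∑ l ∈ Finset.range n,
      (BPw ε m k * BPw ε l 0 + BPw ε m k * BPw ε l k + BPw ε l k * BPw ε m 0 + BPw ε l k * BPw ε m k
        + BPw ε m k * BPw ε l m) ≤ 4 * Q * BPw ε m k + Q * BPw ε m 0 := by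
    intro m
    simp_rw [Finset.sum_add_distrib, ← Finset.mul_sum, ← Finset.sum_mul]
    have w1 := BPw_nonneg ε m k
    have w2 := BPw_nonneg ε m 0
    have := mul_le_mul_of_nonneg_left (hQ n 0) w1
    have := mul_le_mul_of_nonneg_left (hQ n k) w1
    have := mul_le_mul_of_nonneg_left (hQ n m) w1
    have := mul_le_mul_of_nonneg_left (hQ n k) w2
    linarith
  refine (Finset.sum_le_sum fun m _ => hm m).trans ?_
  rw [Finset.sum_add_distrib, ← Finset.mul_sum, ← Finset.mul_sum]
  have := mul_le_mul_of_nonneg_left (hQ n k) (by positivity : 0 ≤ 4 * Q)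
  have := mul_le_mul_of_nonneg_left (hQ n 0) hQ0
  linarith

/-! ### Assembly -/

def BPP (ρ : ℝ → ℝ) (i : ℕ × ℕ) (H : ℝ × ℝ → ℝ) : ℝ × ℝ → ℝ :=
  BPu (lpKernel ρ i.1) (BPv (lpKernel ρ i.2) H)

lemma BPP_B {ρ : ℝ → ℝ} (hρ : IsLPCutoff ρ) (i : ℕ × ℕ) {H : ℝ × ℝ → ℝ} {M : ℝ} (h : BPB H M) :
    ∃ N, BPB (BPP ρ i H) N := ⟨_, (h.v (lpK_int hρ _)).u (lpK_int hρ _)⟩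

lemma BPP_comm {ρ : ℝ → ℝ} (hρ : IsLPCutoff ρ) (i : ℕ × ℕ) {H : ℝ × ℝ → ℝ} {M : ℝ} (h : BPB H M) :
    BPP ρ i H = BPv (lpKernel ρ i.2) (BPu (lpKernel ρ i.1) H) :=
  BP_comm (lpK_int hρ _) (lpK_int hρ _) h

lemma BP_vanish_u {ρ : ℝ → ℝ} (hρ : IsLPCutoff ρ) {k m l : ℕ} (hadm : ¬ BPAdm k m l)
    {F G : ℝ × ℝ → ℝ} {M N : ℝ} (hF : BPB F M) (hG : BPB G N) (p : ℝ × ℝ) :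
    BPu (lpKernel ρ k) (fun q => BPu (lpKernel ρ m) F q * BPu (lpKernel ρ l) G q) p = 0 := by
  have c1 := hF.cont
  have c2 := hG.cont
  exact BP_vanish (lpK_cont hρ k) (lpK_cont hρ m) (lpK_cont hρ l) (lpK_int hρ k) (lpK_int hρ m)
    (lpK_int hρ l) (f := fun x => F (x, p.2)) (g := fun x => G (x, p.2)) (by fun_prop) (by fun_prop)
    (fun x => hF.bd _) (fun x => hG.bd _)
    (BP_triple (BP_sym_lp hρ k) (BP_sym_lp hρ m) (BP_sym_lp hρ l) (BP_symbol_zero hρ hadm)) p.1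

lemma BP_vanish_v {ρ : ℝ → ℝ} (hρ : IsLPCutoff ρ) {k m l : ℕ} (hadm : ¬ BPAdm k m l)
    {F G : ℝ × ℝ → ℝ} {M N : ℝ} (hF : BPB F M) (hG : BPB G N) (p : ℝ × ℝ) :
    BPv (lpKernel ρ k) (fun q => BPv (lpKernel ρ m) F q * BPv (lpKernel ρ l) G q) p = 0 :=
  BP_vanish_u hρ hadm hF.swap hG.swap p.swap

lemma BPP_zero {ρ : ℝ → ℝ} (hρ : IsLPCutoff ρ) {k i j : ℕ × ℕ} {F G : ℝ × ℝ → ℝ} {M N : ℝ}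
    (hF : BPB F M) (hG : BPB G N) (h : ¬ (BPAdm k.1 i.1 j.1 ∧ BPAdm k.2 i.2 j.2)) (p : ℝ × ℝ) :
    BPP ρ k (fun q => BPP ρ i F q * BPP ρ j G q) p = 0 := by
  obtain ⟨A, hA⟩ := BPP_B hρ i hF
  obtain ⟨B, hB⟩ := BPP_B hρ j hG
  by_cases h1 : BPAdm k.1 i.1 j.1
  · have h2 : ¬ BPAdm k.2 i.2 j.2 := fun h2 => h ⟨h1, h2⟩
    have : BPv (lpKernel ρ k.2) (fun q => BPP ρ i F q * BPP ρ j G q) = fun _ => 0 := by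
      ext q
      rw [BPP_comm hρ i hF, BPP_comm hρ j hG]
      exact BP_vanish_v hρ h2 (hF.u (lpK_int hρ _)) (hG.u (lpK_int hρ _)) q
    unfold BPP at this ⊢
    rw [this]
    simp [BPu]
  · rw [BPP_comm hρ k (hA.mul hB)]
    have : BPu (lpKernel ρ k.1) (fun q => BPP ρ i F q * BPP ρ j G q) = fun _ => 0 := by
      ext q
      exact BP_vanish_u hρ h1 (hF.v (lpK_int hρ _)) (hG.v (lpK_int hρ _)) q
    rw [this]
    simp [BPv]

lemma BPP_enorm {ρ : ℝ → ℝ} (hρ : IsLPCutoff ρ) (k : ℕ × ℕ) {H : ℝ × ℝ → ℝ} {A : ℝ≥0∞}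
    (hA : ∀ p, ‖H p‖ₑ ≤ A) (p : ℝ × ℝ) :
    ‖BPP ρ k H p‖ₑ ≤ ENNReal.ofReal ((2 * BPL ρ) ^ 2) * A := by
  have := BPu_enorm (lpK_int hρ k.1)
    (fun q => BPv_enorm (lpK_int hρ k.2) hA (lpK_L1 hρ k.2) q) (lpK_L1 hρ k.1) p
  have hL : 0 ≤ 2 * BPL ρ := by linarith [BPL_nonneg ρ]
  rwa [← mul_assoc, ← ENNReal.ofReal_mul hL, ← pow_two] at this

def BPR (n : ℕ) : Finset (ℕ × ℕ) := Finset.range (n + 1) ×ˢ Finset.range (n + 1)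

lemma BPS_expand {ρ : ℝ → ℝ} (hρ : IsLPCutoff ρ) (n : ℕ) {F : ℝ × ℝ → ℝ} {M : ℝ} (h : BPB F M) :
    BPu (BPD ρ n) (BPv (BPD ρ n) F) = fun p => ∑ i ∈ BPR n, BPP ρ i F p := by
  have hD : BPD ρ n = fun y => ∑ k ∈ Finset.range (n + 1), lpKernel ρ k y := by
    ext y; exact BPD_sum hρ n y
  have hv : BPv (BPD ρ n) F = fun p => ∑ k ∈ Finset.range (n + 1), BPv (lpKernel ρ k) F p := by
    rw [hD]; exact BPv_ksum _ (fun k => lpK_int hρ k) h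
  have hvB := h.v (BPD_int hρ n)
  have hu : BPu (BPD ρ n) (BPv (BPD ρ n) F) = fun p => ∑ k ∈ Finset.range (n + 1),
      BPu (lpKernel ρ k) (BPv (BPD ρ n) F) p :=
    (congrArg (fun K => BPu K (BPv (BPD ρ n) F)) hD).trans
      (BPu_ksum _ (fun k => lpK_int hρ k) hvB)
  rw [hu]
  ext p
  unfold BPR BPP
  rw [Finset.sum_product]
  refine Finset.sum_congr rfl fun k _ => ?_
  rw [hv, BPu_sum _ (lpK_int hρ k) fun j => ⟨_, h.v (lpK_int hρ j)⟩]

lemma BPP_sum {ρ : ℝ → ℝ} (hρ : IsLPCutoff ρ) (k : ℕ × ℕ) {ι : Type*} (s : Finset ι)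
    {H : ι → ℝ × ℝ → ℝ} (h : ∀ i, ∃ M, BPB (H i) M) (p : ℝ × ℝ) :
    BPP ρ k (fun p => ∑ i ∈ s, H i p) p = ∑ i ∈ s, BPP ρ k (H i) p := by
  unfold BPP
  rw [BPv_sum s (lpK_int hρ _) h, BPu_sum s (lpK_int hρ _)]
  intro i
  obtain ⟨M, hM⟩ := h i
  exact ⟨_, hM.v (lpK_int hρ _)⟩

lemma BPP_const (ρ : ℝ → ℝ) (k : ℕ × ℕ) (c : ℝ) (H : ℝ × ℝ → ℝ) (p : ℝ × ℝ) :
    BPP ρ k (fun q => c * H q) p = c * BPP ρ k H p := by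
  have h1 : BPv (lpKernel ρ k.2) (fun q => c * H q) = fun q => c * BPv (lpKernel ρ k.2) H q := by
    ext q
    unfold BPv
    rw [← integral_const_mul]
    congr 1; ext y; ring
  unfold BPP
  rw [h1]
  unfold BPu
  rw [← integral_const_mul]
  congr 1; ext y; ring

lemma BPP_limit {ρ : ℝ → ℝ} (hρ : IsLPCutoff ρ) (k : ℕ × ℕ) {F G : ℝ × ℝ → ℝ} {M N : ℝ}
    (hF : BPB F M) (hG : BPB G N) (p : ℝ × ℝ) :
    Filter.Tendsto (fun n => ∑ i ∈ BPR n, ∑ j ∈ BPR n,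
      BPP ρ k (fun q => BPP ρ i F q * BPP ρ j G q) p) Filter.atTop
      (nhds ((2 * Real.pi) * (2 * Real.pi) * BPP ρ k (fun q => F q * G q) p)) := by
  have hS : ∀ {F : ℝ × ℝ → ℝ} {M : ℝ}, BPB F M → ∀ n,
      BPB (BPu (BPD ρ n) (BPv (BPD ρ n) F)) (BPL ρ * (BPL ρ * M)) := by
    intro F M h n
    have := (h.v (BPD_int hρ n)).u (BPD_int hρ n)
    rwa [BPD_L1] at this
  have hprod := fun n => (hS hF n).mul (hS hG n)
  have ht : ∀ q, Filter.Tendsto (fun n => BPu (BPD ρ n) (BPv (BPD ρ n) F) q *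
      BPu (BPD ρ n) (BPv (BPD ρ n) G) q) Filter.atTop
      (nhds ((2 * Real.pi) * (2 * Real.pi) * (F q * G q))) := by
    intro q
    have := (BP_approx hρ hF q).mul (BP_approx hρ hG q)
    refine this.congr' (Filter.EventuallyEq.refl _ _) |>.trans_eq ?_
    congr 1; ring
  have h1 := BPv_tendsto (lpK_int hρ k.2) hprod ht
  have h2 := BPu_tendsto (lpK_int hρ k.1) (fun n => (hprod n).v (lpK_int hρ k.2)) h1 p
  rw [← BPP_const]
  refine h2.congr fun n => ?_
  rw [BPS_expand hρ n hF, BPS_expand hρ n hG]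
  have e : (fun q => (∑ i ∈ BPR n, BPP ρ i F q) * ∑ j ∈ BPR n, BPP ρ j G q) =
      fun q => ∑ i ∈ BPR n, ∑ j ∈ BPR n, BPP ρ i F q * BPP ρ j G q := by
    ext q; rw [Finset.sum_mul_sum]
  simp only [e]
  have hm : ∀ i j, ∃ C, BPB (fun q => BPP ρ i F q * BPP ρ j G q) C := by
    intro i j
    obtain ⟨A, hA⟩ := BPP_B hρ i hF
    obtain ⟨B, hB⟩ := BPP_B hρ j hG
    exact ⟨_, hA.mul hB⟩
  have hsum : ∀ i, ∃ C, BPB (fun q => ∑ j ∈ BPR n, BPP ρ i F q * BPP ρ j G q) C := by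
    intro i
    choose C hC using hm i
    exact ⟨∑ j ∈ BPR n, C j, continuous_finsetSum _ fun j _ => (hC j).cont, fun q =>
      (Finset.abs_sum_le_sum_abs _ _).trans (Finset.sum_le_sum fun j _ => (hC j).bd q)⟩
  refine (BPP_sum hρ k (BPR n) hsum p).trans (Finset.sum_congr rfl fun i _ => ?_)
  exact BPP_sum hρ k (BPR n) (hm i) p

lemma BPP_le_norm (ρ : ℝ → ℝ) (α₁ α₂ : ℝ) (F : ℝ × ℝ → ℝ) (i : ℕ × ℕ) (p : ℝ × ℝ) :
    ‖BPP ρ i F p‖ₑ ≤ ENNReal.ofReal ((2 : ℝ) ^ (-(α₁ * i.1)) * (2 : ℝ) ^ (-(α₂ * i.2))) *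
      hNorm2 ρ α₁ α₂ F := by
  have h : ENNReal.ofReal (((2 : ℝ) ^ i.1) ^ α₁ * ((2 : ℝ) ^ i.2) ^ α₂) * ‖BPP ρ i F p‖ₑ ≤
      hNorm2 ρ α₁ α₂ F := by
    unfold hNorm2
    refine le_trans ?_ (le_iSup_of_le i.1 (le_iSup_of_le i.2 le_rfl))
    refine mul_le_mul_right ?_ _
    rw [Real.enorm_eq_ofReal_abs]
    exact le_iSup (fun p => ENNReal.ofReal |LPu ρ i.1 (LPv ρ i.2 F) p|) p
  have e : ∀ (a : ℕ) (α : ℝ), (2 : ℝ) ^ (-(α * a)) * ((2 : ℝ) ^ a) ^ α = 1 := by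
    intro a α
    rw [← Real.rpow_natCast, ← Real.rpow_mul (by norm_num), ← Real.rpow_add (by norm_num)]
    rw [show -(α * a) + a * α = 0 by ring, Real.rpow_zero]
  calc ‖BPP ρ i F p‖ₑ = ENNReal.ofReal ((2 : ℝ) ^ (-(α₁ * i.1)) * (2 : ℝ) ^ (-(α₂ * i.2))) *
        (ENNReal.ofReal (((2 : ℝ) ^ i.1) ^ α₁ * ((2 : ℝ) ^ i.2) ^ α₂) * ‖BPP ρ i F p‖ₑ) := by
        rw [← mul_assoc, ← ENNReal.ofReal_mul (by positivity), mul_mul_mul_comm, e, e]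
        simp
    _ ≤ _ := by gcongr

lemma BPP_term {ρ : ℝ → ℝ} (hρ : IsLPCutoff ρ) (α₁ α₂ β₁ β₂ : ℝ) (k i j : ℕ × ℕ)
    {F G : ℝ × ℝ → ℝ} {M N : ℝ} (hF : BPB F M) (hG : BPB G N) (p : ℝ × ℝ) :
    ‖BPP ρ k (fun q => BPP ρ i F q * BPP ρ j G q) p‖ₑ ≤
      ENNReal.ofReal (BPt α₁ β₁ k.1 i.1 j.1 * BPt α₂ β₂ k.2 i.2 j.2) *
      (ENNReal.ofReal ((2 * BPL ρ) ^ 2) * (hNorm2 ρ α₁ α₂ F * hNorm2 ρ β₁ β₂ G)) := by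
  by_cases h : BPAdm k.1 i.1 j.1 ∧ BPAdm k.2 i.2 j.2
  · refine (BPP_enorm hρ k (A := (ENNReal.ofReal ((2 : ℝ) ^ (-(α₁ * i.1)) * (2 : ℝ) ^ (-(α₂ * i.2))) *
      hNorm2 ρ α₁ α₂ F) * (ENNReal.ofReal ((2 : ℝ) ^ (-(β₁ * j.1)) * (2 : ℝ) ^ (-(β₂ * j.2))) *
      hNorm2 ρ β₁ β₂ G)) (fun q => ?_) p).trans_eq ?_
    · rw [enorm_mul]
      exact mul_le_mul' (BPP_le_norm ρ α₁ α₂ F i q) (BPP_le_norm ρ β₁ β₂ G j q)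
    · have e : BPt α₁ β₁ k.1 i.1 j.1 * BPt α₂ β₂ k.2 i.2 j.2 =
          ((2 : ℝ) ^ (-(α₁ * i.1)) * (2 : ℝ) ^ (-(α₂ * i.2))) *
          ((2 : ℝ) ^ (-(β₁ * j.1)) * (2 : ℝ) ^ (-(β₂ * j.2))) := by
        unfold BPt
        rw [if_pos h.1, if_pos h.2, sub_eq_add_neg, sub_eq_add_neg, Real.rpow_add (by norm_num),
          Real.rpow_add (by norm_num)]
        ring
      have e2 := ENNReal.ofReal_mul
        (q := (2 : ℝ) ^ (-(β₁ * j.1)) * (2 : ℝ) ^ (-(β₂ * j.2)))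
        (by positivity : 0 ≤ (2 : ℝ) ^ (-(α₁ * i.1)) * (2 : ℝ) ^ (-(α₂ * i.2)))
      rw [e, e2]
      generalize ENNReal.ofReal ((2 : ℝ) ^ (-(α₁ * i.1)) * (2 : ℝ) ^ (-(α₂ * i.2))) = X
      generalize ENNReal.ofReal ((2 : ℝ) ^ (-(β₁ * j.1)) * (2 : ℝ) ^ (-(β₂ * j.2))) = Y
      ring
  · rw [BPP_zero hρ hF hG h]
    simp

lemma BPR_sum (f g : ℕ → ℕ → ℝ) (n : ℕ) :
    ∑ i ∈ BPR n, ∑ j ∈ BPR n, f i.1 j.1 * g i.2 j.2 =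
      (∑ m ∈ Finset.range (n + 1), ∑ l ∈ Finset.range (n + 1), f m l) *
      (∑ m ∈ Finset.range (n + 1), ∑ l ∈ Finset.range (n + 1), g m l) := by
  unfold BPR
  rw [Finset.sum_mul_sum, Finset.sum_product]
  refine Finset.sum_congr rfl fun a _ => Finset.sum_congr rfl fun b _ => ?_
  rw [Finset.sum_mul_sum, Finset.sum_product]

lemma CbSmooth.bpb {F : ℝ × ℝ → ℝ} (h : CbSmooth F) : ∃ M, BPB F M := by
  obtain ⟨C, hC⟩ := h.2 0
  refine ⟨C, h.1.continuous, fun p => ?_⟩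
  have := hC p
  rwa [norm_iteratedFDeriv_zero] at this

/-- **Proposition 2.6(i): general bilinear paraproduct estimate.**
If `γⱼ ≤ min (αⱼ, βⱼ)` and `αⱼ + βⱼ > 0` for `j = 1, 2` (all exponents nonzero), then
`‖F·G‖_{C_u^{γ₁}C_v^{γ₂}} ≲ ‖F‖_{C_u^{α₁}C_v^{α₂}} ‖G‖_{C_u^{β₁}C_v^{β₂}}` for all `C_b^∞`
functions `F, G : ℝ² → ℝ`. -/
theorem bilinear_paraproduct_general
    (ρ : ℝ → ℝ) (hρ : IsLPCutoff ρ)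
    (α₁ α₂ β₁ β₂ γ₁ γ₂ : ℝ)
    (hα₁ : α₁ ≠ 0) (hα₂ : α₂ ≠ 0) (hβ₁ : β₁ ≠ 0) (hβ₂ : β₂ ≠ 0)
    (hγ₁ : γ₁ ≤ min α₁ β₁) (hγ₂ : γ₂ ≤ min α₂ β₂)
    (hab₁ : 0 < α₁ + β₁) (hab₂ : 0 < α₂ + β₂) :
    ∃ C : ℝ≥0∞, C ≠ ∞ ∧ ∀ F G : ℝ × ℝ → ℝ, CbSmooth F → CbSmooth G →
      hNorm2 ρ γ₁ γ₂ (fun p => F p * G p) ≤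
        C * hNorm2 ρ α₁ α₂ F * hNorm2 ρ β₁ β₂ G := by
  obtain ⟨C₁, hC₁, hs₁⟩ := BP_comb hα₁ hβ₁ hγ₁ hab₁
  obtain ⟨C₂, hC₂, hs₂⟩ := BP_comb hα₂ hβ₂ hγ₂ hab₂
  refine ⟨ENNReal.ofReal (C₁ * C₂) * ENNReal.ofReal ((2 * BPL ρ) ^ 2),
    ENNReal.mul_ne_top ENNReal.ofReal_ne_top ENNReal.ofReal_ne_top, fun F G hF hG => ?_⟩
  obtain ⟨M, hF⟩ := hF.bpb
  obtain ⟨N, hG⟩ := hG.bpb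
  set D : ℝ≥0∞ := ENNReal.ofReal ((2 * BPL ρ) ^ 2) * (hNorm2 ρ α₁ α₂ F * hNorm2 ρ β₁ β₂ G) with hD
  have goal_eq : ENNReal.ofReal (C₁ * C₂) * ENNReal.ofReal ((2 * BPL ρ) ^ 2) * hNorm2 ρ α₁ α₂ F *
      hNorm2 ρ β₁ β₂ G = ENNReal.ofReal (C₁ * C₂) * D := by rw [hD]; ring
  rw [goal_eq]
  refine iSup_le fun k₁ => iSup_le fun k₂ => ?_
  rw [ENNReal.mul_iSup]
  refine iSup_le fun p => ?_
  set W : ℝ := ((2 : ℝ) ^ k₁) ^ γ₁ * ((2 : ℝ) ^ k₂) ^ γ₂ with hW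
  have hW0 : 0 ≤ W := by positivity
  have hWe : W = (2 : ℝ) ^ (γ₁ * k₁) * (2 : ℝ) ^ (γ₂ * k₂) := by
    rw [hW, ← Real.rpow_natCast, ← Real.rpow_natCast, ← Real.rpow_mul (by norm_num),
      ← Real.rpow_mul (by norm_num), mul_comm γ₁, mul_comm γ₂]
  have hlim := BPP_limit hρ (k₁, k₂) hF hG p
  have hlim' := (ENNReal.Tendsto.const_mul (a := ENNReal.ofReal W) hlim.enorm
    (Or.inr ENNReal.ofReal_ne_top))
  have hbound := le_of_tendsto' hlim' (b := ENNReal.ofReal (C₁ * C₂) * D) (fun n => by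
    calc ENNReal.ofReal W * ‖∑ i ∈ BPR n, ∑ j ∈ BPR n,
          BPP ρ (k₁, k₂) (fun q => BPP ρ i F q * BPP ρ j G q) p‖ₑ
        ≤ ENNReal.ofReal W * ∑ i ∈ BPR n, ∑ j ∈ BPR n,
          ENNReal.ofReal (BPt α₁ β₁ k₁ i.1 j.1 * BPt α₂ β₂ k₂ i.2 j.2) * D := by
          gcongr
          refine (enorm_sum_le _ _).trans (Finset.sum_le_sum fun i _ => ?_)
          refine (enorm_sum_le _ _).trans (Finset.sum_le_sum fun j _ => ?_)
          exact BPP_term hρ α₁ α₂ β₁ β₂ (k₁, k₂) i j hF hG p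
      _ = ENNReal.ofReal (W * ∑ i ∈ BPR n, ∑ j ∈ BPR n,
          BPt α₁ β₁ k₁ i.1 j.1 * BPt α₂ β₂ k₂ i.2 j.2) * D := by
          have ht : ∀ i j : ℕ × ℕ, 0 ≤ BPt α₁ β₁ k₁ i.1 j.1 * BPt α₂ β₂ k₂ i.2 j.2 :=
            fun i j => mul_nonneg (BPt_nonneg _ _ _ _ _) (BPt_nonneg _ _ _ _ _)
          rw [ENNReal.ofReal_mul hW0, ENNReal.ofReal_sum_of_nonneg
            (fun i _ => Finset.sum_nonneg fun j _ => ht i j), mul_assoc, Finset.sum_mul]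
          congr 1
          refine Finset.sum_congr rfl fun i _ => ?_
          rw [ENNReal.ofReal_sum_of_nonneg (fun j _ => ht i j), Finset.sum_mul]
      _ ≤ ENNReal.ofReal (C₁ * C₂) * D := by
          refine mul_le_mul' (ENNReal.ofReal_le_ofReal ?_) le_rfl
          rw [BPR_sum (fun m l => BPt α₁ β₁ k₁ m l) (fun m l => BPt α₂ β₂ k₂ m l), hWe,
            mul_mul_mul_comm]
          refine mul_le_mul (hs₁ k₁ (n + 1)) (hs₂ k₂ (n + 1)) ?_ hC₁
          exact mul_nonneg (by positivity) (Finset.sum_nonneg fun m _ =>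
            Finset.sum_nonneg fun l _ => BPt_nonneg _ _ _ _ _))
  refine le_trans ?_ hbound
  refine mul_le_mul_right ?_ _
  rw [Real.enorm_eq_ofReal_abs]
  refine ENNReal.ofReal_le_ofReal ?_
  have hpi : 1 ≤ 2 * Real.pi * (2 * Real.pi) := by nlinarith [Real.pi_gt_three]
  rw [abs_mul, abs_of_nonneg (by linarith : 0 ≤ 2 * Real.pi * (2 * Real.pi))]
  exact le_mul_of_one_le_left (abs_nonneg _) hpi
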